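/- Let H be a finite dimensional Hopf π-coalgebra over a field k, let λ = (λ_α)_{α∈π} be a right π-integral for H, let g = (g_α)_{α∈π} be the distinguished π-grouplike element of H, and let ν be the distinguished grouplike element of H_1*, with convolution inverse ν⁻¹ = ν ∘ S_1. Then for all α ∈ π and x, y ∈ H_α: (a) λ_α(xy) = λ_α(S_{α⁻¹}(S_α(y ↼ ν)) x); (b) λ_α(xy) = λ_α(y · S_{α⁻¹}(S_α(ν⁻¹ ⇀ (g_α⁻¹ x g_α)))); (c) λ_{α⁻¹}(S_α(x)) = λ_α(g_α x). -/

import Mathlib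

open scoped TensorProduct

noncomputable section

/-- Transport of the algebra structure along an equality of group indices. -/
def gcast (k : Type*) [CommSemiring k] {π : Type*} (H : π → Type*)
    [∀ α, Ring (H α)] [∀ α, Algebra k (H α)] {a b : π} (h : a = b) :
    H a ≃ₐ[k] H b := by subst h; exact AlgEquiv.refl

/-- Transport of a module family along an equality of group indices. -/
def fcast (k : Type*) [CommSemiring k] {π : Type*} (M : π → Type*)
    [∀ α, AddCommGroup (M α)] [∀ α, Module k (M α)] {a b : π} (h : a = b) :
    M a ≃ₗ[k] M b := by subst h; exact LinearEquiv.refl k (M a)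

/-- A Hopf `π`-coalgebra (in the sense of Turaev/Virelizier) over a field `k`:
a family of `k`-algebras `H α` with comultiplication `Δ`, counit `ε` and antipode `S`. -/
class HopfGCoalgebra (k : Type*) [Field k] {π : Type*} [Group π]
    (H : π → Type*) [∀ α, Ring (H α)] [∀ α, Algebra k (H α)] where
  Δ : ∀ α β : π, H (α * β) →ₐ[k] H α ⊗[k] H β
  ε : H (1 : π) →ₐ[k] k
  S : ∀ α : π, H α →ₗ[k] H α⁻¹
  coassoc : ∀ α β γ : π,
    (TensorProduct.assoc k (H α) (H β) (H γ)).toLinearMap ∘ₗ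
        (TensorProduct.map (Δ α β).toLinearMap (LinearMap.id : H γ →ₗ[k] H γ)) ∘ₗ
        (Δ (α * β) γ).toLinearMap
      = (TensorProduct.map (LinearMap.id : H α →ₗ[k] H α) (Δ β γ).toLinearMap) ∘ₗ
        (Δ α (β * γ)).toLinearMap ∘ₗ (gcast k H (mul_assoc α β γ)).toLinearMap
  counit_right : ∀ α : π,
    (TensorProduct.rid k (H α)).toLinearMap ∘ₗ
        (TensorProduct.map (LinearMap.id : H α →ₗ[k] H α) ε.toLinearMap) ∘ₗ
        (Δ α 1).toLinearMap ∘ₗ (gcast k H (mul_one α).symm).toLinearMap = LinearMap.id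
  counit_left : ∀ α : π,
    (TensorProduct.lid k (H α)).toLinearMap ∘ₗ
        (TensorProduct.map ε.toLinearMap (LinearMap.id : H α →ₗ[k] H α)) ∘ₗ
        (Δ 1 α).toLinearMap ∘ₗ (gcast k H (one_mul α).symm).toLinearMap = LinearMap.id
  antipode_left : ∀ α : π,
    (LinearMap.mul' k (H α)) ∘ₗ
        (TensorProduct.map ((gcast k H (inv_inv α)).toLinearMap ∘ₗ S α⁻¹)
          (LinearMap.id : H α →ₗ[k] H α)) ∘ₗ (Δ α⁻¹ α).toLinearMap
      = (Algebra.linearMap k (H α)) ∘ₗ ε.toLinearMap ∘ₗ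
        (gcast k H (inv_mul_cancel α)).toLinearMap
  antipode_right : ∀ α : π,
    (LinearMap.mul' k (H α)) ∘ₗ
        (TensorProduct.map (LinearMap.id : H α →ₗ[k] H α)
          ((gcast k H (inv_inv α)).toLinearMap ∘ₗ S α⁻¹)) ∘ₗ (Δ α α⁻¹).toLinearMap
      = (Algebra.linearMap k (H α)) ∘ₗ ε.toLinearMap ∘ₗ
        (gcast k H (mul_inv_cancel α)).toLinearMap

namespace HopfGCoalgebra

variable (k : Type*) [Field k] {π : Type*} [Group π] (H : π → Type*)
  [∀ α, Ring (H α)] [∀ α, Algebra k (H α)] [HopfGCoalgebra k H]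

/-- A left `π`-integral for `H`. -/
def IsLeftIntegral (lam : ∀ α : π, H α →ₗ[k] k) : Prop :=
  ∀ (α β : π) (x : H (α * β)),
    (TensorProduct.rid k (H α))
        (TensorProduct.map (LinearMap.id : H α →ₗ[k] H α) (lam β) (Δ α β x))
      = lam (α * β) x • (1 : H α)

/-- A right `π`-integral for `H`. -/
def IsRightIntegral (lam : ∀ α : π, H α →ₗ[k] k) : Prop :=
  ∀ (α β : π) (x : H (α * β)),
    (TensorProduct.lid k (H β))
        (TensorProduct.map (lam α) (LinearMap.id : H β →ₗ[k] H β) (Δ α β x))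
      = lam (α * β) x • (1 : H β)

/-- A `π`-grouplike element of `H`. -/
def IsGrouplike (g : ∀ α : π, H α) : Prop :=
  (∀ α β : π, Δ α β (g (α * β)) = g α ⊗ₜ[k] g β) ∧ ε (k := k) (H := H) (g 1) = 1

/-- `g` is the distinguished `π`-grouplike element of `H`. -/
def IsDistinguishedGrouplike (g : ∀ α : π, H α) : Prop :=
  IsGrouplike k H g ∧
    ∀ lam : ∀ α : π, H α →ₗ[k] k, IsRightIntegral k H lam →
      ∀ (α β : π) (x : H (α * β)),
        (TensorProduct.rid k (H α))
            (TensorProduct.map (LinearMap.id : H α →ₗ[k] H α) (lam β) (Δ α β x))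
          = lam (α * β) x • g α

/-- `ν` is the distinguished grouplike element of `H₁*`. -/
def IsDistinguishedNu (ν : H (1 : π) →ₐ[k] k) : Prop :=
  ∀ Λ : H (1 : π), (∀ x : H (1 : π), x * Λ = ε (k := k) (H := H) x • Λ) →
    ∀ x : H (1 : π), Λ * x = ν x • Λ

/-- The right action `a ↼ f` of `f ∈ H₁*` on `a ∈ H α`. -/
def hitR (f : H (1 : π) →ₗ[k] k) {α : π} (a : H α) : H α :=
  (TensorProduct.lid k (H α))
    (TensorProduct.map f (LinearMap.id : H α →ₗ[k] H α)
      (Δ 1 α ((gcast k H (one_mul α).symm) a)))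

/-- The left action `f ⇀ a` of `f ∈ H₁*` on `a ∈ H α`. -/
def hitL (f : H (1 : π) →ₗ[k] k) {α : π} (a : H α) : H α :=
  (TensorProduct.rid k (H α))
    (TensorProduct.map (LinearMap.id : H α →ₗ[k] H α) f
      (Δ α 1 ((gcast k H (mul_one α).symm) a)))


/-- The comultiplication, with all arguments explicit. -/
def comul (α β : π) : H (α * β) →ₐ[k] H α ⊗[k] H β := Δ α β

/-- The counit, with all arguments explicit. -/
def counit : H (1 : π) →ₐ[k] k := ε

/-- The antipode, with all arguments explicit. -/
def antipode (α : π) : H α →ₗ[k] H α⁻¹ := S α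

end HopfGCoalgebra

open HopfGCoalgebra
/-- A right Hopf `π`-comodule over `H`. -/
class HopfGComodule (k : Type*) [Field k] {π : Type*} [Group π]
    (H : π → Type*) [∀ α, Ring (H α)] [∀ α, Algebra k (H α)] [HopfGCoalgebra k H]
    (M : π → Type*) [∀ α, AddCommGroup (M α)] [∀ α, Module k (M α)] where
  ρ : ∀ α β : π, M (α * β) →ₗ[k] M α ⊗[k] H β
  ρ_coassoc : ∀ α β γ : π,
    (TensorProduct.assoc k (M α) (H β) (H γ)).toLinearMap ∘ₗ
        (TensorProduct.map (ρ α β) (LinearMap.id : H γ →ₗ[k] H γ)) ∘ₗ (ρ (α * β) γ)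
      = (TensorProduct.map (LinearMap.id : M α →ₗ[k] M α) (Δ β γ).toLinearMap) ∘ₗ
        (ρ α (β * γ)) ∘ₗ (fcast k M (mul_assoc α β γ)).toLinearMap
  ρ_counit : ∀ α : π,
    (TensorProduct.rid k (M α)).toLinearMap ∘ₗ
        (TensorProduct.map (LinearMap.id : M α →ₗ[k] M α)
          (ε (k := k) (H := H)).toLinearMap) ∘ₗ
        (ρ α 1) ∘ₗ (fcast k M (mul_one α).symm).toLinearMap = LinearMap.id
  act : ∀ α : π, M α →ₗ[k] H α →ₗ[k] M α
  act_one : ∀ (α : π) (m : M α), act α m 1 = m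
  act_mul : ∀ (α : π) (m : M α) (a b : H α), act α (act α m a) b = act α m (a * b)
  ρ_act : ∀ (α β : π) (m : M (α * β)) (a : H (α * β)),
    ρ α β (act (α * β) m a)
      = TensorProduct.map (TensorProduct.lift (act α)) (LinearMap.mul' k (H β))
          ((TensorProduct.tensorTensorTensorComm k (M α) (H β) (H α) (H β))
            (ρ α β m ⊗ₜ[k] (Δ α β a)))

namespace HopfGComodule

variable (k : Type*) [Field k] {π : Type*} [Group π] (H : π → Type*)
  [∀ α, Ring (H α)] [∀ α, Algebra k (H α)] [HopfGCoalgebra k H]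
  (M : π → Type*) [∀ α, AddCommGroup (M α)] [∀ α, Module k (M α)] [HopfGComodule k H M]

/-- The submodule of coinvariant families of `H` on `M`. -/
def coinvFam : Submodule k (∀ α, M α) where
  carrier := {m | ∀ α β : π, ρ (H := H) α β (m (α * β)) = m α ⊗ₜ[k] (1 : H β)}
  add_mem' := by
    intro a b ha hb α β
    simp only [Pi.add_apply, map_add, ha α β, hb α β, TensorProduct.add_tmul]
  zero_mem' := by
    intro α β
    simp only [Pi.zero_apply, map_zero, TensorProduct.zero_tmul]
  smul_mem' := by
    intro c a ha α β
    simp only [Pi.smul_apply, map_smul, ha α β, TensorProduct.smul_tmul']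

/-- The `α`-component of the `π`-subcomodule of coinvariants. -/
def coinvSub (α : π) : Submodule k (M α) :=
  (coinvFam k H M).map (LinearMap.proj α : (∀ γ, M γ) →ₗ[k] M α)


/-- The comodule structure maps, with all arguments explicit. -/
def coact (α β : π) : M (α * β) →ₗ[k] M α ⊗[k] H β := ρ α β

/-- The right `H α`-action on `M α`, with all arguments explicit. -/
def hact (α : π) : M α →ₗ[k] H α →ₗ[k] M α := act α

end HopfGComodule

section Cosemisimple

variable (k : Type*) [Field k] {π : Type*} [Group π] (H : π → Type*)
  [∀ α, Ring (H α)] [∀ α, Algebra k (H α)]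
  (M : π → Type*) [∀ α, AddCommGroup (M α)] [∀ α, Module k (M α)]

/-- `N` is a `π`-subcomodule of the right `π`-comodule `(M, ρ)` over `H`. -/
def IsGSubcomodule (ρ : ∀ α β : π, M (α * β) →ₗ[k] M α ⊗[k] H β)
    (N : ∀ α, Submodule k (M α)) : Prop :=
  ∀ (α β : π), ∀ x ∈ N (α * β),
    ρ α β x ∈ LinearMap.range
      (TensorProduct.map (N α).subtype (LinearMap.id : H β →ₗ[k] H β))

/-- `N` is a simple `π`-subcomodule of `(M, ρ)`. -/
def IsSimpleGSubcomodule (ρ : ∀ α β : π, M (α * β) →ₗ[k] M α ⊗[k] H β)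
    (N : ∀ α, Submodule k (M α)) : Prop :=
  IsGSubcomodule k H M ρ N ∧ (∃ α, N α ≠ ⊥) ∧
    ∀ P : ∀ α, Submodule k (M α), IsGSubcomodule k H M ρ P → (∀ α, P α ≤ N α) →
      (∀ α, P α = ⊥) ∨ P = N

/-- The right `π`-comodule `(M, ρ)` is cosemisimple: it is the sum of its simple
`π`-subcomodules. -/
def IsGCosemisimple (ρ : ∀ α β : π, M (α * β) →ₗ[k] M α ⊗[k] H β) : Prop :=
  ∀ α : π,
    (⨆ N : {N : ∀ γ, Submodule k (M γ) // IsSimpleGSubcomodule k H M ρ N}, N.1 α) = ⊤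

end Cosemisimple

section CoalgCosemisimple

variable (k : Type*) [Field k] (C : Type*) [AddCommGroup C] [Module k C]

/-- `N` is a subcomodule of the coalgebra `(C, δ)` viewed as a right comodule over itself. -/
def IsSubcoideal (δ : C →ₗ[k] C ⊗[k] C) (N : Submodule k C) : Prop :=
  ∀ x ∈ N, δ x ∈ LinearMap.range (TensorProduct.map N.subtype (LinearMap.id : C →ₗ[k] C))

def IsSimpleSubcoideal (δ : C →ₗ[k] C ⊗[k] C) (N : Submodule k C) : Prop :=
  IsSubcoideal k C δ N ∧ N ≠ ⊥ ∧
    ∀ P : Submodule k C, IsSubcoideal k C δ P → P ≤ N → P = ⊥ ∨ P = N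

/-- The coalgebra `(C, δ)` is cosemisimple. -/
def IsCosemisimpleCoalgebra (δ : C →ₗ[k] C ⊗[k] C) : Prop :=
  (⨆ N : {N : Submodule k C // IsSimpleSubcoideal k C δ N}, N.1) = ⊤

end CoalgCosemisimple
/-- A crossed Hopf `π`-coalgebra: a Hopf `π`-coalgebra with a crossing `φ`. -/
class CrossedHopfGCoalgebra (k : Type*) [Field k] {π : Type*} [Group π]
    (H : π → Type*) [∀ α, Ring (H α)] [∀ α, Algebra k (H α)]
    extends HopfGCoalgebra k H where
  φ : ∀ β α : π, H α ≃ₐ[k] H (β * α * β⁻¹)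
  φ_comul : ∀ β α γ : π,
    (TensorProduct.map (φ β α).toLinearMap (φ β γ).toLinearMap) ∘ₗ (Δ α γ).toLinearMap
      = (Δ (β * α * β⁻¹) (β * γ * β⁻¹)).toLinearMap ∘ₗ
        (gcast k H (show β * (α * γ) * β⁻¹ = (β * α * β⁻¹) * (β * γ * β⁻¹) by
          group)).toLinearMap ∘ₗ (φ β (α * γ)).toLinearMap
  φ_counit : ∀ (β : π) (x : H (1 : π)),
    ε ((gcast k H (show β * 1 * β⁻¹ = (1 : π) by group)) (φ β 1 x)) = ε x
  φ_mul : ∀ (β β' α : π) (x : H α),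
    (gcast k H (show β * (β' * α * β'⁻¹) * β⁻¹ = (β * β') * α * (β * β')⁻¹ by group))
        (φ β (β' * α * β'⁻¹) (φ β' α x))
      = φ (β * β') α x


namespace CrossedHopfGCoalgebra

variable (k : Type*) [Field k] {π : Type*} [Group π] (H : π → Type*)
  [∀ α, Ring (H α)] [∀ α, Algebra k (H α)] [CrossedHopfGCoalgebra k H]

/-- The crossing, with all arguments explicit. -/
def crossing (β α : π) : H α ≃ₐ[k] H (β * α * β⁻¹) := φ β α

end CrossedHopfGCoalgebra

open CrossedHopfGCoalgebra

/-- A quasitriangular Hopf `π`-coalgebra: a crossed Hopf `π`-coalgebra with an R-matrix. -/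
class QTHopfGCoalgebra (k : Type*) [Field k] {π : Type*} [Group π]
    (H : π → Type*) [∀ α, Ring (H α)] [∀ α, Algebra k (H α)]
    extends CrossedHopfGCoalgebra k H where
  Rm : ∀ α β : π, H α ⊗[k] H β
  Rm_isUnit : ∀ α β : π, IsUnit (Rm α β)
  Rm_comul : ∀ (α β : π) (x : H (α * β)),
    Rm α β * Δ α β x
      = (TensorProduct.comm k (H β) (H α))
          ((TensorProduct.map
              ((gcast k H (show α⁻¹ * (α * β * α⁻¹) * α⁻¹⁻¹ = β by group)).toLinearMap ∘ₗ
                (φ α⁻¹ (α * β * α⁻¹)).toLinearMap)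
              (LinearMap.id : H α →ₗ[k] H α))
            ((Δ (α * β * α⁻¹) α)
              ((gcast k H (show α * β = (α * β * α⁻¹) * α by group)) x))) * Rm α β
  Rm_delta_right : ∀ α β γ : π,
    TensorProduct.map (LinearMap.id : H α →ₗ[k] H α) (Δ β γ).toLinearMap (Rm α (β * γ))
      = (TensorProduct.map (LinearMap.id : H α →ₗ[k] H α)
            (TensorProduct.mk k (H β) (H γ) 1) (Rm α γ))
        * (TensorProduct.map (LinearMap.id : H α →ₗ[k] H α)
            ((TensorProduct.mk k (H β) (H γ)).flip 1) (Rm α β))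
  Rm_delta_left : ∀ α β γ : π,
    (TensorProduct.assoc k (H α) (H β) (H γ))
        (TensorProduct.map (Δ α β).toLinearMap (LinearMap.id : H γ →ₗ[k] H γ)
          (Rm (α * β) γ))
      = (TensorProduct.map (LinearMap.id : H α →ₗ[k] H α)
            (TensorProduct.mk k (H β) (H γ) 1)
            (TensorProduct.map (LinearMap.id : H α →ₗ[k] H α)
              ((gcast k H (show β⁻¹ * (β * γ * β⁻¹) * β⁻¹⁻¹ = γ by group)).toLinearMap ∘ₗ
                (φ β⁻¹ (β * γ * β⁻¹)).toLinearMap)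
              (Rm α (β * γ * β⁻¹))))
        * (TensorProduct.mk k (H α) (H β ⊗[k] H γ) 1 (Rm β γ))
  Rm_phi : ∀ β α γ : π,
    TensorProduct.map (φ β α).toLinearMap (φ β γ).toLinearMap (Rm α γ)
      = Rm (β * α * β⁻¹) (β * γ * β⁻¹)

namespace QTHopfGCoalgebra

variable (k : Type*) [Field k] {π : Type*} [Group π] (H : π → Type*)
  [∀ α, Ring (H α)] [∀ α, Algebra k (H α)] [QTHopfGCoalgebra k H]

/-- The square of the antipode `S_{α⁻¹} ∘ S_α : H α → H α`. -/
def antipodeSq (α : π) : H α →ₗ[k] H α :=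
  (gcast k H (inv_inv α)).toLinearMap ∘ₗ S α⁻¹ ∘ₗ S α

/-- The map `S_{α⁻¹} ∘ φ_α : H (α⁻¹) → H α`. -/
def sphi (α : π) : H α⁻¹ →ₗ[k] H α :=
  (gcast k H (inv_inv α)).toLinearMap ∘ₗ S α⁻¹ ∘ₗ
    (gcast k H (show α * α⁻¹ * α⁻¹ = α⁻¹ by group)).toLinearMap ∘ₗ
    (φ α α⁻¹).toLinearMap

/-- The Drinfeld element `u_α = m_α ∘ (S_{α⁻¹}φ_α ⊗ id) ∘ σ_{α,α⁻¹} (R_{α,α⁻¹})`. -/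
def drinfeld (α : π) : H α :=
  LinearMap.mul' k (H α)
    (TensorProduct.map (sphi k H α) (LinearMap.id : H α →ₗ[k] H α)
      ((TensorProduct.comm k (H α) (H α⁻¹)) (Rm α α⁻¹)))

/-- The element `S_{α⁻¹}(u_{α⁻¹}) ∈ H α`. -/
def sdrinfeld (α : π) : H α :=
  (gcast k H (inv_inv α)) (S (k := k) (H := H) α⁻¹ (drinfeld k H α⁻¹))

/-- The `π`-grouplike element `ℓ_α = S_{α⁻¹}(u_{α⁻¹})⁻¹ u_α`. -/
def ell (α : π) : H α :=
  Ring.inverse (sdrinfeld k H α) * drinfeld k H α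


/-- The R-matrix, with all arguments explicit. -/
def rmatrix (α β : π) : H α ⊗[k] H β := Rm α β

end QTHopfGCoalgebra

open QTHopfGCoalgebra

namespace HopfGCoalgebra

open TensorProduct

section Contraction

variable {k : Type*} [Field k]

/-- Contraction of the left tensor factor against a linear form. -/
def contractLeft {M N : Type*} [AddCommGroup M] [Module k M] [AddCommGroup N] [Module k N]
    (f : M →ₗ[k] k) : M ⊗[k] N →ₗ[k] N :=
  (TensorProduct.lid k N).toLinearMap ∘ₗ TensorProduct.map f LinearMap.id

/-- Contraction of the right tensor factor against a linear form. -/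
def contractRight {M N : Type*} [AddCommGroup M] [Module k M] [AddCommGroup N] [Module k N]
    (f : N →ₗ[k] k) : M ⊗[k] N →ₗ[k] M :=
  (TensorProduct.rid k M).toLinearMap ∘ₗ TensorProduct.map LinearMap.id f

variable {M N P Q : Type*} [AddCommGroup M] [Module k M] [AddCommGroup N] [Module k N]
  [AddCommGroup P] [Module k P] [AddCommGroup Q] [Module k Q]

@[simp]
theorem contractLeft_tmul (f : M →ₗ[k] k) (m : M) (n : N) :
    contractLeft f (m ⊗ₜ[k] n) = f m • n := by
  simp [contractLeft]

@[simp]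
theorem contractRight_tmul (f : N →ₗ[k] k) (m : M) (n : N) :
    contractRight f (m ⊗ₜ[k] n) = f n • m := by
  simp [contractRight]

/-- A tensor killed by all contractions `B · y` on the left is killed by every linear map that
vanishes on `ker B ⊗ N`. -/
theorem map_eq_zero_of_contractLeft (B : M →ₗ[k] P →ₗ[k] k) (t : M ⊗[k] N)
    (ht : ∀ y, contractLeft (B.flip y) t = 0) (F : M ⊗[k] N →ₗ[k] Q)
    (hF : ∀ m n, B m = 0 → F (m ⊗ₜ[k] n) = 0) : F t = 0 := by
  classical
  obtain ⟨b, rfl⟩ := TensorProduct.eq_repr_basis_right (Module.Basis.ofVectorSpace k N) t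
  simp only [Finsupp.sum, map_sum, contractLeft_tmul] at ht ⊢
  refine Finset.sum_eq_zero fun i hi => hF _ _ ?_
  ext y
  exact linearIndependent_iff'.1 (Module.Basis.ofVectorSpace k N).linearIndependent _ _
    (ht y) i hi

variable {A B : Type*} [Ring A] [Algebra k A] [Ring B] [Algebra k B]

theorem contractLeft_mul_one_tmul (f : A →ₗ[k] k) (t : A ⊗[k] B) (c : B) :
    contractLeft f (t * (1 ⊗ₜ[k] c)) = contractLeft f t * c := by
  induction t with
  | zero => simp
  | tmul a b => simp
  | add a b ha hb => simp only [add_mul, map_add, ha, hb]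

theorem contractRight_tmul_one_mul (f : B →ₗ[k] k) (t : A ⊗[k] B) (c : A) :
    contractRight f ((c ⊗ₜ[k] 1) * t) = c * contractRight f t := by
  induction t with
  | zero => simp
  | tmul a b => simp
  | add a b ha hb => simp only [mul_add, map_add, ha, hb]

theorem contractLeft_mul_tmul_one (f : A →ₗ[k] k) (t : A ⊗[k] B) (y : A) :
    contractLeft f (t * (y ⊗ₜ[k] 1)) = contractLeft (f ∘ₗ LinearMap.mulRight k y) t := by
  induction t with
  | zero => simp
  | tmul a b => simp
  | add a b ha hb => simp only [add_mul, map_add, ha, hb]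

theorem contractRight_one_tmul_mul (f : B →ₗ[k] k) (t : A ⊗[k] B) (y : B) :
    contractRight f ((1 ⊗ₜ[k] y) * t) = contractRight (f ∘ₗ LinearMap.mulLeft k y) t := by
  induction t with
  | zero => simp
  | tmul a b => simp
  | add a b ha hb => simp only [mul_add, map_add, ha, hb]

end Contraction

variable {k : Type*} [Field k] {π : Type*} [Group π] {H : π → Type*}
  [∀ α, Ring (H α)] [∀ α, Algebra k (H α)] [HopfGCoalgebra k H]

/-- The component `H γ → H α ⊗ H β` of the comultiplication, for any factorisation of `γ`. -/
def comulOf {α β γ : π} (h : α * β = γ) : H γ →ₐ[k] H α ⊗[k] H β :=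
  (Δ α β).comp (gcast k H h.symm).toAlgHom

/-- The component `H α → H β` of the antipode, for any inverse `β` of `α`. -/
def antipodeOf {α β : π} (h : α * β = 1) : H α →ₗ[k] H β :=
  (gcast k H (inv_eq_of_mul_eq_one_right h)).toLinearMap ∘ₗ S α

theorem comulOf_coassoc {α β γ p q t : π} (h₁ : α * β = p) (h₂ : p * γ = t) (h₃ : β * γ = q)
    (h₄ : α * q = t) (x : H t) :
    TensorProduct.assoc k (H α) (H β) (H γ)
        (TensorProduct.map (comulOf h₁).toLinearMap LinearMap.id (comulOf (k := k) h₂ x))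
      = TensorProduct.map LinearMap.id (comulOf h₃).toLinearMap (comulOf h₄ x) := by
  subst h₁ h₃ h₂
  exact LinearMap.congr_fun (coassoc α β γ) x

theorem contractRight_counit {α : π} (h : α * 1 = α) (x : H α) :
    contractRight (ε (k := k) (H := H)).toLinearMap (comulOf h x) = x :=
  LinearMap.congr_fun (counit_right (k := k) α) x

theorem contractLeft_counit {α : π} (h : 1 * α = α) (x : H α) :
    contractLeft (ε (k := k) (H := H)).toLinearMap (comulOf h x) = x :=
  LinearMap.congr_fun (counit_left (k := k) α) x

theorem mul_antipodeOf_left {α β : π} (h : α * β = 1) (x : H (1 : π)) :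
    LinearMap.mul' k (H β) (TensorProduct.map (antipodeOf h) LinearMap.id
      (comulOf (k := k) h x)) = (ε (k := k) (H := H) x) • 1 := by
  obtain rfl : α = β⁻¹ := eq_inv_of_mul_eq_one_left h
  have := LinearMap.congr_fun (antipode_left (k := k) (H := H) β) (gcast k H h.symm x)
  refine this.trans ?_
  have hx : gcast k H (inv_mul_cancel β) (gcast k H h.symm x) = x := by
    generalize_proofs h₁ h₂
    revert h₁ h₂
    generalize β⁻¹ * β = c
    rintro rfl h₂
    rfl
  simp [Algebra.algebraMap_eq_smul_one, hx]

theorem mul_antipodeOf_right {α β : π} (h : α * β = 1) (h' : β * α = 1) (x : H (1 : π)) :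
    LinearMap.mul' k (H α) (TensorProduct.map LinearMap.id (antipodeOf h')
      (comulOf (k := k) h x)) = (ε (k := k) (H := H) x) • 1 := by
  obtain rfl : β = α⁻¹ := eq_inv_of_mul_eq_one_left h'
  have := LinearMap.congr_fun (antipode_right (k := k) (H := H) α) (gcast k H h.symm x)
  refine this.trans ?_
  have hx : gcast k H (mul_inv_cancel α) (gcast k H h.symm x) = x := by
    generalize_proofs h₁ h₂
    revert h₁ h₂
    generalize α * α⁻¹ = c
    rintro rfl h₂
    rfl
  simp [Algebra.algebraMap_eq_smul_one, hx]

/-- The map `a ⊗ b ↦ Δ(a) (1 ⊗ S(b))`. -/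
def comulMulAntipode {α β γ δ : π} (h : α * β = γ) (hδ : δ * β = 1) :
    H γ ⊗[k] H δ →ₗ[k] H α ⊗[k] H β :=
  TensorProduct.lift ((LinearMap.mul k (H α ⊗[k] H β)).compl₁₂ (comulOf h).toLinearMap
    (TensorProduct.mk k (H α) (H β) 1 ∘ₗ antipodeOf hδ))

@[simp]
theorem comulMulAntipode_tmul {α β γ δ : π} (h : α * β = γ) (hδ : δ * β = 1)
    (a : H γ) (b : H δ) :
    comulMulAntipode (k := k) h hδ (a ⊗ₜ[k] b)
      = comulOf h a * (1 ⊗ₜ[k] antipodeOf (k := k) hδ b) := rfl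

/-- The map `a ⊗ b ↦ (S(a) ⊗ 1) Δ(b)`. -/
def antipodeMulComul {α β γ δ : π} (h : α * β = γ) (hδ : δ * α = 1) :
    H δ ⊗[k] H γ →ₗ[k] H α ⊗[k] H β :=
  TensorProduct.lift ((LinearMap.mul k (H α ⊗[k] H β)).compl₁₂
    ((TensorProduct.mk k (H α) (H β)).flip 1 ∘ₗ antipodeOf hδ) (comulOf h).toLinearMap)

@[simp]
theorem antipodeMulComul_tmul {α β γ δ : π} (h : α * β = γ) (hδ : δ * α = 1)
    (a : H δ) (b : H γ) :
    antipodeMulComul (k := k) h hδ (a ⊗ₜ[k] b)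
      = (antipodeOf (k := k) hδ a ⊗ₜ[k] 1) * comulOf h b := rfl

theorem comulMulAntipode_comulOf {α β γ δ : π} (h : α * β = γ) (hδ : δ * β = 1)
    (hγ : γ * δ = α) (y : H α) :
    comulMulAntipode (k := k) h hδ (comulOf hγ y) = y ⊗ₜ[k] 1 := by
  have hδ' : β * δ = 1 := mul_eq_one_iff_eq_inv.2 (eq_inv_of_mul_eq_one_right hδ)
  have key : ∀ w : H γ ⊗[k] H δ, comulMulAntipode (k := k) h hδ w
      = TensorProduct.map LinearMap.id (LinearMap.mul' k (H β) ∘ₗ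
          TensorProduct.map LinearMap.id (antipodeOf hδ))
        (TensorProduct.assoc k (H α) (H β) (H δ)
          (TensorProduct.map (comulOf h).toLinearMap LinearMap.id w)) := by
    intro w
    induction w with
    | zero => simp
    | add a b ha hb => simp only [map_add, ha, hb]
    | tmul a b =>
      simp only [comulMulAntipode_tmul, TensorProduct.map_tmul, AlgHom.toLinearMap_apply,
        LinearMap.id_apply]
      induction comulOf (k := k) h a with
      | zero => simp
      | add a b ha hb => simp only [map_add, add_mul, add_tmul, ha, hb]
      | tmul c d => simp
  rw [key, comulOf_coassoc h hγ hδ' (mul_one α), ← LinearMap.comp_apply,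
    ← TensorProduct.map_comp]
  conv_rhs => rw [← contractRight_counit (k := k) (mul_one α) y]
  induction comulOf (k := k) (mul_one α) y with
  | zero => simp
  | add a b ha hb => simp only [map_add, add_tmul, ha, hb]
  | tmul c d =>
    have := mul_antipodeOf_right (k := k) hδ' hδ d
    simp [this, smul_tmul]

theorem antipodeMulComul_comulOf {α β γ δ : π} (h : α * β = γ) (hδ : δ * α = 1)
    (hγ : δ * γ = β) (y : H β) :
    antipodeMulComul (k := k) h hδ (comulOf hγ y) = 1 ⊗ₜ[k] y := by
  have key : ∀ w : H δ ⊗[k] H γ, antipodeMulComul (k := k) h hδ w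
      = TensorProduct.map (LinearMap.mul' k (H α) ∘ₗ
          TensorProduct.map (antipodeOf hδ) LinearMap.id) LinearMap.id
        ((TensorProduct.assoc k (H δ) (H α) (H β)).symm
          (TensorProduct.map LinearMap.id (comulOf h).toLinearMap w)) := by
    intro w
    induction w with
    | zero => simp
    | add a b ha hb => simp only [map_add, ha, hb]
    | tmul a b =>
      simp only [antipodeMulComul_tmul, TensorProduct.map_tmul, AlgHom.toLinearMap_apply,
        LinearMap.id_apply]
      induction comulOf (k := k) h b with
      | zero => simp
      | add a b ha hb => simp only [map_add, mul_add, tmul_add, ha, hb]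
      | tmul c d => simp
  rw [key, ← comulOf_coassoc hδ (one_mul β) h hγ, LinearEquiv.symm_apply_apply,
    ← LinearMap.comp_apply, ← TensorProduct.map_comp]
  conv_rhs => rw [← contractLeft_counit (k := k) (one_mul β) y]
  induction comulOf (k := k) (one_mul β) y with
  | zero => simp
  | add a b ha hb => simp only [map_add, tmul_add, ha, hb]
  | tmul c d =>
    have := mul_antipodeOf_left (k := k) hδ c
    simp [this, smul_tmul]

/-- The map `a ⊗ b ↦ S(a) b`. -/
def antipodeMul {α β : π} (h : α * β = 1) : H α ⊗[k] H β →ₗ[k] H β :=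
  LinearMap.mul' k (H β) ∘ₗ TensorProduct.map (antipodeOf h) LinearMap.id

@[simp]
theorem antipodeMul_tmul {α β : π} (h : α * β = 1) (a : H α) (b : H β) :
    antipodeMul (k := k) h (a ⊗ₜ[k] b) = antipodeOf (k := k) h a * b := by
  simp [antipodeMul]

theorem antipodeMul_comulOf_mul {α β : π} (h : α * β = 1) (a : H (1 : π)) (c : H β) :
    antipodeMul h (comulOf h a * (1 ⊗ₜ[k] c)) = ε (k := k) (H := H) a • c := by
  have : ∀ t : H α ⊗[k] H β, antipodeMul h (t * (1 ⊗ₜ[k] c)) = antipodeMul h t * c := by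
    intro t
    induction t with
    | zero => simp
    | add a b ha hb => simp only [map_add, add_mul, ha, hb]
    | tmul a b => simp [mul_assoc]
  rw [this, antipodeMul, LinearMap.comp_apply, mul_antipodeOf_left]
  simp

theorem antipodeOf_mul {α β : π} (h : α * β = 1) (x y : H α) :
    antipodeOf (k := k) h (x * y) = antipodeOf (k := k) h y * antipodeOf (k := k) h x := by
  have hy : ∀ (a : H (1 : π)) (s : H β), antipodeMul h
      (comulOf h a * (y ⊗ₜ[k] 1) * (1 ⊗ₜ[k] s))
        = ε (k := k) (H := H) a • (antipodeOf (k := k) h y * s) := by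
    intro a s
    rw [← comulMulAntipode_comulOf h h (one_mul α) y]
    conv_rhs => rw [← contractLeft_counit (k := k) (one_mul α) y]
    induction comulOf (k := k) (one_mul α) y with
    | zero => simp
    | add a b ha hb => simp only [map_add, mul_add, add_mul, smul_add, ha, hb]
    | tmul c d =>
      rw [comulMulAntipode_tmul, ← mul_assoc, ← map_mul, mul_assoc,
        Algebra.TensorProduct.tmul_mul_tmul, one_mul, antipodeMul_comulOf_mul]
      simp [mul_smul]
  have hx : antipodeOf (k := k) h (x * y) = antipodeMul h ((x ⊗ₜ[k] 1) * (y ⊗ₜ[k] 1)) := by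
    simp
  rw [hx, ← comulMulAntipode_comulOf h h (one_mul α) x]
  conv_rhs => rw [← contractLeft_counit (k := k) (one_mul α) x]
  induction comulOf (k := k) (one_mul α) x with
  | zero => simp
  | add a b ha hb => simp only [map_add, mul_add, add_mul, ha, hb]
  | tmul c d =>
    have hcomm : (1 ⊗ₜ[k] antipodeOf (k := k) h d) * (y ⊗ₜ[k] (1 : H β))
        = (y ⊗ₜ[k] 1) * (1 ⊗ₜ[k] antipodeOf (k := k) h d) := by simp
    rw [comulMulAntipode_tmul, mul_assoc, hcomm, ← mul_assoc, hy]
    simp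

/-- The left action of `f` on `H α` as a linear map. -/
def hitLMap (f : H (1 : π) →ₗ[k] k) (α : π) : H α →ₗ[k] H α :=
  contractRight f ∘ₗ (comulOf (mul_one α)).toLinearMap

/-- The right action of `f` on `H α` as a linear map. -/
def hitRMap (f : H (1 : π) →ₗ[k] k) (α : π) : H α →ₗ[k] H α :=
  contractLeft f ∘ₗ (comulOf (one_mul α)).toLinearMap

theorem map_hitRMap_comulOf (f : H (1 : π) →ₗ[k] k) {α β γ : π} (h : α * β = γ) (x : H γ) :
    TensorProduct.map LinearMap.id (hitRMap f β) (comulOf h x)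
      = TensorProduct.map (hitLMap f α) LinearMap.id (comulOf (k := k) h x) := by
  have assoc_contract : ∀ t : (H α ⊗[k] H (1 : π)) ⊗[k] H β,
      TensorProduct.map LinearMap.id (contractLeft f) (TensorProduct.assoc k _ _ _ t)
        = TensorProduct.map (contractRight f) LinearMap.id t := by
    intro t
    induction t with
    | zero => simp
    | add a b ha hb => simp only [map_add, ha, hb]
    | tmul p c =>
      induction p with
      | zero => simp
      | add a b ha hb => simp only [map_add, add_tmul, ha, hb]
      | tmul a b => simp [smul_tmul]
  have hco := congrArg (TensorProduct.map LinearMap.id (contractLeft f))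
    (comulOf_coassoc (k := k) (mul_one α) h (one_mul β) h x)
  rw [assoc_contract, ← LinearMap.comp_apply, ← LinearMap.comp_apply, ← TensorProduct.map_comp,
    ← TensorProduct.map_comp] at hco
  exact hco.symm

theorem hitLMap_antipode_hitLMap (ν : H (1 : π) →ₐ[k] k) (h : (1 : π) * 1 = 1) {α : π}
    (x : H α) :
    hitLMap (ν.toLinearMap ∘ₗ antipodeOf h) α (hitLMap ν.toLinearMap α x) = x := by
  set N : H (1 : π) ⊗[k] H (1 : π) →ₗ[k] k := ν.toLinearMap ∘ₗ antipodeMul h with hN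
  have hNε : N ∘ₗ (comulOf h).toLinearMap = (ε (k := k) (H := H)).toLinearMap := by
    ext z
    simp [hN, antipodeMul, mul_antipodeOf_left]
  have merge : ∀ t : H α ⊗[k] H (1 : π),
      hitLMap (ν.toLinearMap ∘ₗ antipodeOf h) α (contractRight ν.toLinearMap t)
        = contractRight N (TensorProduct.assoc k _ _ _
            (TensorProduct.map (comulOf (mul_one α)).toLinearMap LinearMap.id t)) := by
    intro t
    induction t with
    | zero => simp
    | add a b ha hb => simp only [map_add, ha, hb]
    | tmul a b =>
      simp only [hitLMap, contractRight_tmul, map_smul, LinearMap.comp_apply,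
        AlgHom.toLinearMap_apply, TensorProduct.map_tmul, LinearMap.id_apply]
      induction comulOf (k := k) (mul_one α) a with
      | zero => simp
      | add a b ha hb => simp only [map_add, add_tmul, smul_add, ha, hb]
      | tmul c d => simp [hN, smul_smul, mul_comm]
  have push : ∀ t : H α ⊗[k] H (1 : π),
      contractRight N (TensorProduct.map LinearMap.id (comulOf h).toLinearMap t)
        = contractRight (N ∘ₗ (comulOf h).toLinearMap) t := by
    intro t
    induction t with
    | zero => simp
    | add a b ha hb => simp only [map_add, ha, hb]
    | tmul a b => simp
  rw [hitLMap, hitLMap, LinearMap.comp_apply (contractRight ν.toLinearMap), ← hitLMap, merge,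
    AlgHom.toLinearMap_apply, comulOf_coassoc (mul_one α) (mul_one α) h (mul_one α), push, hNε,
    contractRight_counit]

theorem hitRMap_mul (ν : H (1 : π) →ₐ[k] k) {α : π} (x y : H α) :
    hitRMap ν.toLinearMap α (x * y)
      = hitRMap ν.toLinearMap α x * hitRMap ν.toLinearMap α y := by
  have key : ∀ s t : H (1 : π) ⊗[k] H α, contractLeft ν.toLinearMap (s * t)
      = contractLeft ν.toLinearMap s * contractLeft ν.toLinearMap t := by
    intro s t
    induction s with
    | zero => simp
    | add a b ha hb => simp only [map_add, add_mul, ha, hb]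
    | tmul a b =>
      induction t with
      | zero => simp
      | add a b ha hb => simp only [map_add, mul_add, ha, hb]
      | tmul c d => simp [smul_smul, mul_comm]
  simp [hitRMap, key]

theorem hitRMap_one (ν : H (1 : π) →ₐ[k] k) (α : π) :
    hitRMap ν.toLinearMap α (1 : H α) = 1 := by
  simp [hitRMap, Algebra.TensorProduct.one_def]

theorem hitRMap_antipodeOf (ν : H (1 : π) →ₐ[k] k) (h₁ : (1 : π) * 1 = 1) {α β : π}
    (h : α * β = 1) (w : H α) :
    hitRMap ν.toLinearMap β (antipodeOf (k := k) h w)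
      = antipodeOf (k := k) h (hitLMap (ν.toLinearMap ∘ₗ antipodeOf h₁) α w) := by
  set L := hitLMap (ν.toLinearMap ∘ₗ antipodeOf h₁) α
  set R := hitRMap ν.toLinearMap β
  have hmul : ∀ (t : H α ⊗[k] H β) (c : H β), TensorProduct.map L R (t * (1 ⊗ₜ[k] c))
      = TensorProduct.map L R t * (1 ⊗ₜ[k] R c) := by
    intro t c
    induction t with
    | zero => simp
    | add a b ha hb => simp only [map_add, add_mul, ha, hb]
    | tmul a b => simp [R, hitRMap_mul]
  have hΔ : ∀ a : H (1 : π), TensorProduct.map L R (comulOf h a) = comulOf (k := k) h a := by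
    intro a
    have : TensorProduct.map L R
        = TensorProduct.map L LinearMap.id ∘ₗ TensorProduct.map LinearMap.id R := by
      rw [← TensorProduct.map_comp]; simp
    rw [this, LinearMap.comp_apply, map_hitRMap_comulOf, ← LinearMap.comp_apply,
      ← TensorProduct.map_comp]
    have hid : L ∘ₗ hitLMap ν.toLinearMap α = LinearMap.id :=
      LinearMap.ext fun x => hitLMap_antipode_hitLMap ν h₁ x
    rw [hid]; simp
  have hw : antipodeOf (k := k) h (L w)
      = antipodeMul h (TensorProduct.map L R (w ⊗ₜ[k] (1 : H β))) := by
    simp [R, hitRMap_one]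
  rw [hw, ← comulMulAntipode_comulOf h h (one_mul α) w]
  conv_lhs => rw [← contractLeft_counit (k := k) (one_mul α) w]
  induction comulOf (k := k) (one_mul α) w with
  | zero => simp
  | add a b ha hb => simp only [map_add, ha, hb]
  | tmul c d =>
    rw [comulMulAntipode_tmul, hmul, hΔ, antipodeMul_comulOf_mul]
    simp

section Integral

variable {lam : ∀ α : π, H α →ₗ[k] k}

theorem IsRightIntegral.contractLeft_comulOf (hlam : IsRightIntegral k H lam) {α β γ : π}
    (h : α * β = γ) (x : H γ) :
    contractLeft (lam α) (comulOf (k := k) h x) = lam γ x • (1 : H β) := by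
  subst h
  exact hlam α β x

theorem IsDistinguishedGrouplike.contractRight_comulOf {g : ∀ α : π, H α}
    (hg : IsDistinguishedGrouplike k H g) (hlam : IsRightIntegral k H lam) {α β γ : π}
    (h : α * β = γ) (x : H γ) :
    contractRight (lam β) (comulOf (k := k) h x) = lam γ x • g α := by
  subst h
  exact hg.2 lam hlam α β x

theorem IsGrouplike.comulOf_eq {g : ∀ α : π, H α} (hg : IsGrouplike k H g) {α β γ : π}
    (h : α * β = γ) : comulOf h (g γ) = g α ⊗ₜ[k] g β := by
  subst h
  exact hg.1 α β

theorem IsGrouplike.antipodeOf_mul_self {g : ∀ α : π, H α} (hg : IsGrouplike k H g) {α β : π}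
    (h : α * β = 1) : antipodeOf (k := k) h (g α) * g β = 1 := by
  have := mul_antipodeOf_left (k := k) h (g 1)
  rw [hg.comulOf_eq h, hg.2] at this
  simpa using this

theorem IsGrouplike.self_mul_antipodeOf {g : ∀ α : π, H α} (hg : IsGrouplike k H g) {α β : π}
    (h : α * β = 1) (h' : β * α = 1) : g α * antipodeOf (k := k) h' (g β) = 1 := by
  have := mul_antipodeOf_right (k := k) h h' (g 1)
  rw [hg.comulOf_eq h, hg.2] at this
  simpa using this

/-- In Sweedler notation, `λ(x₁ y) x₂ = λ(x y₁) S(y₂)`. -/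
theorem IsRightIntegral.contractLeft_mulRight (hlam : IsRightIntegral k H lam)
    {α β γ δ : π} (h : α * β = γ) (hδ : δ * β = 1) (hγ : γ * δ = α) (x : H γ) (y : H α) :
    contractLeft (lam α ∘ₗ LinearMap.mulRight k y) (comulOf (k := k) h x)
      = contractLeft (lam γ ∘ₗ LinearMap.mulLeft k x)
          (TensorProduct.map LinearMap.id (antipodeOf hδ) (comulOf (k := k) hγ y)) := by
  rw [← contractLeft_mul_tmul_one, ← comulMulAntipode_comulOf h hδ hγ y]
  induction comulOf (k := k) hγ y with
  | zero => simp
  | add a b ha hb => simp only [map_add, mul_add, ha, hb]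
  | tmul a b =>
    rw [comulMulAntipode_tmul, ← mul_assoc, ← map_mul, contractLeft_mul_one_tmul,
      hlam.contractLeft_comulOf]
    simp

theorem IsRightIntegral.eq_zero_of_one_eq_zero (hlam : IsRightIntegral k H lam)
    (h₁ : lam 1 = 0) (α : π) (x : H α) : lam α x = 0 := by
  have h := hlam.contractLeft_comulOf (one_mul α) x
  rcases smul_eq_zero.1 (h.symm.trans (by simp [h₁, contractLeft])) with h | h
  · exact h
  · have : x = 0 := by rw [← mul_one x, h, mul_zero]
    simp [this]

/-- The bilinear form `(x, y) ↦ f (x y)`. -/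
def mulForm {A : Type*} [Ring A] [Algebra k A] (f : A →ₗ[k] k) : A →ₗ[k] A →ₗ[k] k :=
  (LinearMap.mul k A).compr₂ f

@[simp]
theorem mulForm_apply {A : Type*} [Ring A] [Algebra k A] (f : A →ₗ[k] k) (x y : A) :
    mulForm f x y = f (x * y) := rfl

theorem flip_bijective_of_injective {A : Type*} [AddCommGroup A] [Module k A]
    [FiniteDimensional k A] {B : A →ₗ[k] A →ₗ[k] k} (hB : Function.Injective B) :
    Function.Bijective B.flip :=
  LinearMap.flip_bijective_iff₁.2
    ⟨hB, (LinearMap.injective_iff_surjective_of_finrank_eq_finrank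
      (Subspace.dual_finrank_eq (K := k) (V := A)).symm).1 hB⟩

theorem IsRightIntegral.mulForm_injective_one (hlam : IsRightIntegral k H lam)
    (h₁ : lam 1 ≠ 0) : Function.Injective (mulForm (lam 1)) := by
  have h : (1 : π) * 1 = 1 := one_mul 1
  have hker : ∀ x, mulForm (lam 1) x = 0 → ∀ y,
      contractLeft ((mulForm (lam 1)).flip y) (comulOf (k := k) h x) = 0 := by
    intro x hx y
    have := hlam.contractLeft_mulRight h h h x y
    have hx' : lam 1 ∘ₗ LinearMap.mulLeft k x = 0 := hx
    rw [hx'] at this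
    exact this.trans (by simp [contractLeft])
  have hε : ∀ x, mulForm (lam 1) x = 0 → ε (k := k) (H := H) x = 0 := by
    intro x hx
    obtain ⟨y, hy⟩ : ∃ y, lam 1 y ≠ 0 := by
      by_contra! hcon
      exact h₁ (LinearMap.ext hcon)
    have := map_eq_zero_of_contractLeft _ _ (hker x hx)
      (lam 1 ∘ₗ LinearMap.mulRight k y ∘ₗ LinearMap.mul' k (H (1 : π)) ∘ₗ
        TensorProduct.map LinearMap.id (antipodeOf h)) (fun m n hm => by
          simpa [mul_assoc] using LinearMap.congr_fun hm (antipodeOf (k := k) h n * y))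
    simp only [LinearMap.comp_apply, mul_antipodeOf_right] at this
    simpa [hy] using this
  refine (injective_iff_map_eq_zero _).2 fun x hx => ?_
  rw [← contractLeft_counit (k := k) h x]
  exact map_eq_zero_of_contractLeft _ _ (hker x hx) _ fun m n hm => by simp [hε m hm]

theorem IsRightIntegral.exists_leftIntegral [FiniteDimensional k (H (1 : π))]
    (hlam : IsRightIntegral k H lam) (h₁ : lam 1 ≠ 0) :
    ∃ Λ : H (1 : π), (∀ x, lam 1 (x * Λ) = ε (k := k) (H := H) x) ∧
      ∀ x, x * Λ = ε (k := k) (H := H) x • Λ := by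
  have hflip := flip_bijective_of_injective (hlam.mulForm_injective_one h₁)
  obtain ⟨Λ, hΛ⟩ := hflip.2 (ε (k := k) (H := H)).toLinearMap
  have hΛ' : ∀ x, lam 1 (x * Λ) = ε (k := k) (H := H) x := fun x => LinearMap.congr_fun hΛ x
  refine ⟨Λ, hΛ', fun x => hflip.1 (LinearMap.ext fun y => ?_)⟩
  simp [← mul_assoc, hΛ', mul_comm]

variable {Λ : H (1 : π)}

theorem IsRightIntegral.contractLeft_mulLeft_integral (hlam : IsRightIntegral k H lam)
    (hΛ : ∀ x, lam 1 (x * Λ) = ε (k := k) (H := H) x) {β δ : π} (h : β * δ = 1)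
    (h' : δ * β = 1) (x : H β) :
    contractLeft (lam β ∘ₗ LinearMap.mulLeft k x)
      (TensorProduct.map LinearMap.id (antipodeOf h') (comulOf (k := k) h Λ)) = x := by
  rw [← hlam.contractLeft_mulRight (one_mul β) h' h x Λ]
  have : lam 1 ∘ₗ LinearMap.mulRight k Λ = (ε (k := k) (H := H)).toLinearMap :=
    LinearMap.ext hΛ
  rw [this, contractLeft_counit]

theorem IsRightIntegral.contractRight_antipodeOf_integral [∀ α, FiniteDimensional k (H α)]
    (hlam : IsRightIntegral k H lam) (hΛ : ∀ x, lam 1 (x * Λ) = ε (k := k) (H := H) x)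
    {β δ : π} (h : β * δ = 1) (h' : δ * β = 1) :
    contractRight (lam β ∘ₗ antipodeOf h') (comulOf (k := k) h Λ) = 1 := by
  have hdual := hlam.contractLeft_mulLeft_integral hΛ h h'
  have hinj : Function.Injective (mulForm (lam β)) := by
    refine (injective_iff_map_eq_zero _).2 fun x hx => ?_
    have hx' : lam β ∘ₗ LinearMap.mulLeft k x = 0 := hx
    rw [← hdual x, hx']
    simp [contractLeft]
  refine (flip_bijective_of_injective hinj).1 (LinearMap.ext fun x => ?_)
  have := congrArg (lam β) (hdual x)
  simp only [LinearMap.flip_apply, mulForm_apply, mul_one]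
  refine Eq.trans ?_ this
  induction comulOf (k := k) h Λ with
  | zero => simp
  | add a b ha hb => simp only [map_add, mul_add, ha, hb]
  | tmul a b => simp [mul_comm]

/-- In Sweedler notation, `Λ₁ y ⊗ Λ₂ = Λ₁ ⊗ Λ₂ S(y ↼ ν)`. -/
theorem comulOf_integral_mul_tmul_one {ν : H (1 : π) →ₐ[k] k} (hΛ : ∀ x, Λ * x = ν x • Λ)
    {β δ : π} (h : β * δ = 1) (y : H β) :
    comulOf h Λ * (y ⊗ₜ[k] 1)
      = comulOf h Λ * (1 ⊗ₜ[k] antipodeOf (k := k) h (hitRMap ν.toLinearMap β y)) := by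
  rw [← comulMulAntipode_comulOf h h (one_mul β) y, hitRMap, LinearMap.comp_apply,
    AlgHom.toLinearMap_apply]
  induction comulOf (k := k) (one_mul β) y with
  | zero => simp
  | add a b ha hb => simp only [map_add, tmul_add, mul_add, ha, hb]
  | tmul a b =>
    rw [comulMulAntipode_tmul, ← mul_assoc, ← map_mul, hΛ]
    simp

/-- The Nakayama automorphism of a right integral, in terms of `ν`. -/
theorem IsRightIntegral.apply_mul_eq_hitR [∀ α, FiniteDimensional k (H α)]
    (hlam : IsRightIntegral k H lam) {ν : H (1 : π) →ₐ[k] k} (hν : IsDistinguishedNu k H ν)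
    {β δ : π} (h : β * δ = 1) (h' : δ * β = 1) (x y : H β) :
    lam β (x * y) = lam β (antipodeOf (k := k) h' (antipodeOf (k := k) h
      (hitRMap ν.toLinearMap β y)) * x) := by
  by_cases h₁ : lam 1 = 0
  · simp only [hlam.eq_zero_of_one_eq_zero h₁]
  obtain ⟨Λ, hΛ, hΛl⟩ := hlam.exists_leftIntegral h₁
  set c := hitRMap ν.toLinearMap β y
  have hone := hlam.contractRight_antipodeOf_integral hΛ h h'
  have hdual := hlam.contractLeft_mulLeft_integral hΛ h h' x
  have hcomm := comulOf_integral_mul_tmul_one (hν Λ hΛl) h y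
  have hl : ∀ t : H β ⊗[k] H δ, lam β (contractLeft (lam β ∘ₗ LinearMap.mulLeft k x)
      (TensorProduct.map LinearMap.id (antipodeOf h') (t * (y ⊗ₜ[k] 1))))
        = lam β (x * contractRight (lam β ∘ₗ antipodeOf h') t * y) := by
    intro t
    induction t with
    | zero => simp
    | add a b ha hb => simp only [map_add, add_mul, mul_add, ha, hb]
    | tmul a b => simp [mul_assoc, mul_comm]
  have hr : ∀ t : H β ⊗[k] H δ, contractLeft (lam β ∘ₗ LinearMap.mulLeft k x)
      (TensorProduct.map LinearMap.id (antipodeOf h')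
        (t * (1 ⊗ₜ[k] antipodeOf (k := k) h c)))
        = antipodeOf (k := k) h' (antipodeOf (k := k) h c) *
          contractLeft (lam β ∘ₗ LinearMap.mulLeft k x)
            (TensorProduct.map LinearMap.id (antipodeOf h') t) := by
    intro t
    induction t with
    | zero => simp
    | add a b ha hb => simp only [map_add, add_mul, mul_add, ha, hb]
    | tmul a b => simp [antipodeOf_mul]
  have := hl (comulOf h Λ)
  rw [hone, mul_one, hcomm, hr, hdual] at this
  exact this.symm

theorem IsRightIntegral.apply_antipodeOf [∀ α, FiniteDimensional k (H α)]
    (hlam : IsRightIntegral k H lam) {g : ∀ α : π, H α} (hg : IsDistinguishedGrouplike k H g)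
    {β α : π} (h' : β * α = 1) (x : H β) :
    lam α (antipodeOf (k := k) h' x) = lam β (g β * x) := by
  by_cases h₁ : lam 1 = 0
  · simp only [hlam.eq_zero_of_one_eq_zero h₁]
  have h : α * β = 1 := mul_eq_one_iff_eq_inv.2 (eq_inv_of_mul_eq_one_right h')
  obtain ⟨Λ, hΛ, -⟩ := hlam.exists_leftIntegral h₁
  have hleft : ∀ y : H β, contractRight (lam β ∘ₗ LinearMap.mulLeft k y) (comulOf (k := k) h Λ)
      = antipodeOf (k := k) h' y * g α := by
    intro y
    rw [← contractRight_one_tmul_mul, ← antipodeMulComul_comulOf h h' (mul_one β) y]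
    conv_rhs => rw [← contractRight_counit (k := k) (mul_one β) y]
    induction comulOf (k := k) (mul_one β) y with
    | zero => simp
    | add a b ha hb => simp only [map_add, add_mul, ha, hb]
    | tmul a b =>
      rw [antipodeMulComul_tmul, mul_assoc, ← map_mul, contractRight_tmul_one_mul,
        hg.contractRight_comulOf hlam, hΛ]
      simp
  have hswap : ∀ (y : H β) (t : H α ⊗[k] H β),
      lam α (contractRight (lam β ∘ₗ LinearMap.mulLeft k y) t)
        = lam β (y * contractLeft (lam α) t) := by
    intro y t
    induction t with
    | zero => simp
    | add a b ha hb => simp only [map_add, mul_add, ha, hb]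
    | tmul a b => simp [mul_comm]
  have hΛ₁ : lam 1 Λ = 1 := by simpa using hΛ 1
  have := hswap (g β * x) (comulOf h Λ)
  rwa [hleft, hlam.contractLeft_comulOf, hΛ₁, one_smul, mul_one, antipodeOf_mul, mul_assoc,
    hg.1.antipodeOf_mul_self, mul_one] at this

theorem IsRightIntegral.apply_grouplike_mul_mul [∀ α, FiniteDimensional k (H α)]
    (hlam : IsRightIntegral k H lam) {g : ∀ α : π, H α} (hg : IsDistinguishedGrouplike k H g)
    {ν : H (1 : π) →ₐ[k] k} (hν : IsDistinguishedNu k H ν) (h₁ : (1 : π) * 1 = 1)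
    {β δ : π} (h : β * δ = 1) (h' : δ * β = 1) (w y : H β) :
    lam β (g β * (w * y)) = lam β (g β * (y * antipodeOf (k := k) h' (antipodeOf (k := k) h
      (hitLMap (ν.toLinearMap ∘ₗ antipodeOf h₁) β w)))) := by
  rw [← hlam.apply_antipodeOf hg h, ← hlam.apply_antipodeOf hg h, antipodeOf_mul,
    antipodeOf_mul, hlam.apply_mul_eq_hitR hν h' h, hitRMap_antipodeOf ν h₁ h]

end Integral

end HopfGCoalgebra

/-- Theorem 4.2: relations between a right `π`-integral, the distinguished
`π`-grouplike element `g`, and the distinguished grouplike element `ν` of `H₁*`. -/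
theorem integral_trace_relations (k : Type*) [Field k] {π : Type*} [Group π]
    (H : π → Type*) [∀ α, Ring (H α)] [∀ α, Algebra k (H α)] [HopfGCoalgebra k H]
    [∀ α, FiniteDimensional k (H α)]
    (lam : ∀ α : π, H α →ₗ[k] k) (hlam : IsRightIntegral k H lam)
    (g : ∀ α : π, H α) (hg : IsDistinguishedGrouplike k H g)
    (ν : H (1 : π) →ₐ[k] k) (hν : IsDistinguishedNu k H ν) :
    (∀ (α : π) (x y : H α),
      lam α (x * y)
        = lam α ((gcast k H (inv_inv α))
            (antipode k H α⁻¹ (antipode k H α (hitR k H ν.toLinearMap y))) * x)) ∧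
    (∀ (α : π) (x y : H α),
      lam α (x * y)
        = lam α (y * (gcast k H (inv_inv α))
            (antipode k H α⁻¹ (antipode k H α
              (hitL k H
                (ν.toLinearMap ∘ₗ (gcast k H (inv_one (G := π))).toLinearMap ∘ₗ
                  antipode k H 1)
                ((gcast k H (inv_inv α)) (antipode k H α⁻¹ (g α⁻¹)) * x * g α)))))) ∧
    (∀ (α : π) (x : H α),
      lam α⁻¹ (antipode k H α x) = lam α (g α * x)) := by
  refine ⟨fun α x y => ?_, fun α x y => ?_, fun α x => ?_⟩
  · exact hlam.apply_mul_eq_hitR hν (mul_inv_cancel α) (inv_mul_cancel α) x y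
  · have hinv := hg.1.self_mul_antipodeOf (mul_inv_cancel α) (inv_mul_cancel α)
    have key := hlam.apply_grouplike_mul_mul hg hν (one_mul 1) (mul_inv_cancel α)
      (inv_mul_cancel α) (antipodeOf (k := k) (inv_mul_cancel α) (g α⁻¹) * x * g α)
      (antipodeOf (k := k) (inv_mul_cancel α) (g α⁻¹) * y)
    simp only [← mul_assoc, hinv, one_mul] at key
    rw [mul_assoc x, hinv, mul_one] at key
    exact key
  · exact hlam.apply_antipodeOf hg (mul_inv_cancel α) x
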